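/- Let E be a real Hilbert space, f: E → ℝ a smooth function, ψ: ℝ × E → E a negative gradient flow of f, and N ⊆ E compact. Suppose f is Morse on N, i.e. crit(f) ∩ N ⊆ interior(N) and at every critical point x ∈ crit(f) ∩ N the Hessian of f (the derivative of the map ∇f at x, a continuous linear map E → E) is invertible. Then the maximal invariant set of ψ in N is the union of the intersections of local unstable and stable sets over pairs of critical points in N: Inv(N,ψ) = ⋃_{x,y ∈ crit(f) ∩ N} W^u_loc(x;N) ∩ W^s_loc(y;N). -/

import Mathlib

open Set Filter

open scoped Topology

section Trajectory

variable {E : Type*} [NormedAddCommGroup E] [NormedSpace ℝ E]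

/-- Along a trajectory of a continuous vector field `V` that stays in a compact set, with a bounded
function whose derivative along it is `‖V‖ ^ 2`, every `ω`-limit point is a zero of `V`. -/
theorem eq_zero_of_mapClusterPt_atTop {V : E → E} (hV : Continuous V) {N : Set E}
    (hN : IsCompact N) {u : ℝ → E} (hu : ∀ t, HasDerivAt u (V (u t)) t) (huN : ∀ t, u t ∈ N)
    {F : ℝ → ℝ} (hF : ∀ t, HasDerivAt F (‖V (u t)‖ ^ 2) t) (hFb : BddAbove (range F))
    {p : E} (hp : MapClusterPt p atTop u) : V p = 0 := by
  by_contra hne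
  obtain ⟨M, hM⟩ := hN.exists_bound_of_continuousOn hV.continuousOn
  have hM1 : 0 < max M 1 := lt_max_of_lt_right one_pos
  set ε := ‖V p‖ / 2 with hε
  have hε0 : 0 < ε := by have := norm_pos_iff.2 hne; positivity
  have hnear : ∀ᶠ x in 𝓝 p, ε < ‖V x‖ :=
    hV.norm.continuousAt.eventually_const_lt (by rw [hε]; have := norm_pos_iff.2 hne; linarith)
  obtain ⟨r, hr, hball⟩ := Metric.eventually_nhds_iff.1 hnear
  set δ := r / 2 / max M 1 with hδ
  have hδ0 : 0 < δ := by positivity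
  have hlip : ∀ s t, ‖u t - u s‖ ≤ max M 1 * ‖t - s‖ := fun s t =>
    convex_univ.norm_image_sub_le_of_norm_hasDerivWithin_le
      (fun x _ => (hu x).hasDerivWithinAt)
      (fun x _ => (hM _ (huN x)).trans (le_max_left _ _)) (mem_univ s) (mem_univ t)
  have hFmono : Monotone F := monotone_of_deriv_nonneg (fun t => (hF t).differentiableAt)
    fun t => by rw [(hF t).deriv]; positivity
  have hlim := tendsto_atTop_ciSup hFmono hFb
  have hgain : 0 < ε ^ 2 * δ := by positivity
  obtain ⟨t, ht1, ht2⟩ := ((mapClusterPt_iff_frequently.1 hp _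
    (Metric.ball_mem_nhds p (half_pos hr))).and_eventually
    (hlim.eventually_const_lt (sub_lt_self _ hgain))).exists
  have hstep : ε ^ 2 * (t + δ - t) ≤ F (t + δ) - F t := by
    refine (convex_Icc t (t + δ)).mul_sub_le_image_sub_of_le_deriv
      (fun x _ => (hF x).continuousAt.continuousWithinAt)
      (fun x _ => (hF x).differentiableAt.differentiableWithinAt) (fun x hx => ?_)
      t (left_mem_Icc.2 (by linarith)) (t + δ) (right_mem_Icc.2 (by linarith)) (by linarith)
    rw [(hF x).deriv]
    have hx' := interior_subset hx
    have hd : dist (u x) p < r := by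
      have h1 := hlip t x
      have h2 : ‖x - t‖ ≤ δ := by
        rw [Real.norm_eq_abs, abs_of_nonneg (by linarith [hx'.1])]; linarith [hx'.2]
      have h3 : max M 1 * ‖x - t‖ ≤ r / 2 := by
        calc _ ≤ max M 1 * δ := by gcongr
          _ = r / 2 := by rw [hδ]; field_simp
      have h4 := dist_triangle (u x) (u t) p
      rw [dist_eq_norm (u x) (u t)] at h4
      have h5 := Metric.mem_ball.1 ht1
      linarith
    have := hball hd
    gcongr
  have := le_ciSup hFb (t + δ)
  linarith

/-- Under the assumptions of `eq_zero_of_mapClusterPt_atTop`, if the zeros of `V` in the compact set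
are isolated then the trajectory converges to one of them. -/
theorem exists_tendsto_zero_of_isolated_zeros {V : E → E} (hV : Continuous V) {N : Set E}
    (hN : IsCompact N) (hiso : ∀ p ∈ N, V p = 0 → ∀ᶠ x in 𝓝[≠] p, V x ≠ 0)
    {u : ℝ → E} (hu : ∀ t, HasDerivAt u (V (u t)) t) (huN : ∀ t, u t ∈ N)
    {F : ℝ → ℝ} (hF : ∀ t, HasDerivAt F (‖V (u t)‖ ^ 2) t) (hFb : BddAbove (range F)) :
    ∃ p ∈ N, V p = 0 ∧ Tendsto u atTop (𝓝 p) := by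
  have hzero : ∀ {q}, MapClusterPt q atTop u → V q = 0 :=
    fun hq => eq_zero_of_mapClusterPt_atTop hV hN hu huN hF hFb hq
  have hcont : Continuous u := continuous_iff_continuousAt.2 fun t => (hu t).continuousAt
  obtain ⟨p, hpN, hp⟩ := hN.exists_mapClusterPt (f := atTop) (u := u)
    (tendsto_principal.2 (Eventually.of_forall huN))
  refine ⟨p, hpN, hzero hp, hN.tendsto_nhds_of_unique_mapClusterPt (Eventually.of_forall huN) ?_⟩
  intro q _ hq
  by_contra hqp
  obtain ⟨ρ, hρ, hball⟩ := Metric.eventually_nhds_iff.1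
    (eventually_nhdsWithin_iff.1 (hiso p hpN (hzero hp)))
  set r := min ρ (dist q p) / 2 with hr
  have hdist : 0 < dist q p := dist_pos.2 hqp
  have hr0 : 0 < r := by positivity
  have hrρ : r < ρ := by have := min_le_left ρ (dist q p); linarith
  have hrq : r < dist q p := by have := min_le_right ρ (dist q p); linarith
  have hnear : ∃ᶠ t in atTop, dist (u t) p < r :=
    mapClusterPt_iff_frequently.1 hp _ (Metric.ball_mem_nhds p hr0)
  have hfar : ∃ᶠ t in atTop, r < dist (u t) p := mapClusterPt_iff_frequently.1 hq _
    ((isOpen_lt continuous_const (continuous_id.dist continuous_const)).mem_nhds hrq)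
  have hsphere : ∃ᶠ t in atTop, u t ∈ N ∩ Metric.sphere p r := by
    rw [frequently_atTop] at hnear hfar ⊢
    intro T
    obtain ⟨a, haT, ha⟩ := hnear T
    obtain ⟨b, hbT, hb⟩ := hfar T
    obtain ⟨t, htT, ht⟩ := (isPreconnected_Ici (a := T)).intermediate_value haT hbT
      (hcont.dist continuous_const).continuousOn ⟨ha.le, hb.le⟩
    exact ⟨t, htT, huN t, ht⟩
  obtain ⟨s, hs, hsu⟩ :=
    (hN.inter_right Metric.isClosed_sphere).exists_mapClusterPt_of_frequently hsphere
  have hsr : dist s p = r := hs.2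
  exact hball (hsr.trans_lt hrρ) (dist_pos.1 (hsr.symm ▸ hr0)) (hzero hsu)

end Trajectory

theorem ContDiff.differentiable_gradient {E : Type*} [NormedAddCommGroup E] [InnerProductSpace ℝ E]
    [CompleteSpace E] {f : E → ℝ} (hf : ContDiff ℝ 2 f) : Differentiable ℝ (gradient f) := by
  have h : Differentiable ℝ (fderiv ℝ f) :=
    (hf.fderiv_right (m := 1) (by norm_num)).differentiable (by norm_num)
  exact (InnerProductSpace.toDual ℝ E).symm.toContinuousLinearEquiv.differentiable.comp h

/-- A zero at which the derivative is bijective is isolated. -/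
theorem eventually_ne_zero_of_bijective_fderiv {E F : Type*} [NormedAddCommGroup E]
    [NormedSpace ℝ E] [CompleteSpace E] [NormedAddCommGroup F] [NormedSpace ℝ F] [CompleteSpace F]
    {g : E → F} {p : E} (hg : DifferentiableAt ℝ g p)
    (hb : Function.Bijective (fderiv ℝ g p)) : ∀ᶠ x in 𝓝[≠] p, g x ≠ 0 := by
  let e := ContinuousLinearEquiv.ofBijective (fderiv ℝ g p)
    (LinearMap.ker_eq_bot.2 hb.1) (LinearMap.range_eq_top.2 hb.2)
  exact hg.hasFDerivAt.eventually_ne ⟨_, e.antilipschitz⟩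

/-- If `f` is Morse on the compact set `N` (critical points of `f` in `N`
lie in the interior of `N` and have invertible Hessian), then the maximal invariant set
of the negative gradient flow `ψ` in `N` is the union, over pairs of critical points
`x, y ∈ crit(f) ∩ N`, of `W^u_loc(x; N) ∩ W^s_loc(y; N)`. -/
theorem statement7
    {E : Type*} [NormedAddCommGroup E] [InnerProductSpace ℝ E] [CompleteSpace E]
    (f : E → ℝ) (hfsmooth : ContDiff ℝ (⊤ : ℕ∞) f)
    (ψ : ℝ × E → E)
    (hψ0 : ∀ x, ψ (0, x) = x)
    (hψgrp : ∀ t s x, ψ (t, ψ (s, x)) = ψ (t + s, x))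
    (hψode : ∀ t x, HasDerivAt (fun s => ψ (s, x)) (-(gradient f (ψ (t, x)))) t)
    (N : Set E) (hNcpt : IsCompact N)
    (hcrit_int : {p | gradient f p = 0} ∩ N ⊆ interior N)
    (hnondeg : ∀ p ∈ {p | gradient f p = 0} ∩ N,
      Function.Bijective (fderiv ℝ (gradient f) p)) :
    {z ∈ N | ∀ t, ψ (t, z) ∈ N} =
      ⋃ x ∈ {p | gradient f p = 0} ∩ N, ⋃ y ∈ {p | gradient f p = 0} ∩ N,
        ({z | (∀ t ≤ (0:ℝ), ψ (t, z) ∈ N) ∧ Tendsto (fun t => ψ (t, z)) atBot (nhds x)} ∩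
         {z | (∀ t ≥ (0:ℝ), ψ (t, z) ∈ N) ∧ Tendsto (fun t => ψ (t, z)) atTop (nhds y)}) := by
  have hgrad : Differentiable ℝ (gradient f) :=
    (hfsmooth.of_le (WithTop.coe_le_coe.2 le_top)).differentiable_gradient
  have hiso : ∀ p ∈ N, gradient f p = 0 → ∀ᶠ x in 𝓝[≠] p, gradient f x ≠ 0 := fun p hpN hp =>
    eventually_ne_zero_of_bijective_fderiv (hgrad p) (hnondeg p ⟨hp, hpN⟩)
  have hf : Differentiable ℝ f := hfsmooth.differentiable (by simp)
  obtain ⟨C, hC⟩ := hNcpt.exists_bound_of_continuousOn hf.continuous.continuousOn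
  ext z
  simp only [mem_iUnion, mem_inter_iff, mem_ofPred_eq, exists_prop]
  constructor
  · rintro ⟨-, hz⟩
    have hfψ : ∀ t, HasDerivAt (fun s => f (ψ (s, z))) (-‖gradient f (ψ (t, z))‖ ^ 2) t := by
      intro t
      have h := (hf (ψ (t, z))).hasGradientAt.hasFDerivAt.comp_hasDerivAt t (hψode t z)
      rwa [InnerProductSpace.toDual_apply_apply, inner_neg_right, real_inner_self_eq_norm_sq] at h
    have hneg : ∀ t, HasDerivAt (fun s : ℝ => -s) (-1) t := fun t => (hasDerivAt_id t).neg
    obtain ⟨y, hyN, hy0, hy⟩ := exists_tendsto_zero_of_isolated_zeros (V := fun x => -gradient f x)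
      (F := fun t => -f (ψ (t, z))) hgrad.continuous.neg hNcpt (by simpa using hiso)
      (fun t => hψode t z) hz (fun t => by simpa using (hfψ t).fun_neg)
      ⟨C, by rintro _ ⟨t, rfl⟩; exact (neg_le_abs _).trans (hC _ (hz t))⟩
    obtain ⟨x, hxN, hx0, hx⟩ := exists_tendsto_zero_of_isolated_zeros (V := gradient f)
      (u := fun t => ψ (-t, z)) (F := fun t => f (ψ (-t, z))) hgrad.continuous hNcpt hiso
      (fun t => by simpa [Function.comp_def] using (hψode (-t) z).scomp t (hneg t)) (fun t => hz (-t))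
      (fun t => by simpa [Function.comp_def] using (hfψ (-t)).scomp t (hneg t))
      ⟨C, by rintro _ ⟨t, rfl⟩; exact (le_abs_self _).trans (hC _ (hz (-t)))⟩
    refine ⟨x, ⟨hx0, hxN⟩, y, ⟨neg_eq_zero.1 hy0, hyN⟩, ⟨fun t _ => hz t, ?_⟩, fun t _ => hz t, hy⟩
    simpa [Function.comp_def] using hx.comp tendsto_neg_atBot_atTop
  · rintro ⟨x, -, y, -, ⟨hneg, -⟩, hpos, -⟩
    exact ⟨by simpa [hψ0] using hneg 0 le_rfl, fun t => (le_total t 0).elim (hneg t) (hpos t)⟩
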